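/- For every nonnegative integer $n$, the finite summation identity $\sum_{k=0}^{n}(3+4k)\frac{((1)_k)^3(-n)_k}{((3/2)_k)^3(5/2+n)_k}\Big\{4H_{1+2k}^{(2)}-2H_k^{(2)}\Big\} = \frac{3+2n}{1+2n}\sum_{k=0}^{n}\frac{(1/2)_k(1)_k(-n)_k}{((3/2)_k)^2(1/2-n)_k}\Big\{4H_{1+2k}^{(2)}-H_k^{(2)}\Big\}$ holds. -/

import Mathlib

open scoped BigOperators

/-- The shifted factorial (Pochhammer symbol) `(x)_n = x (x+1) ⋯ (x+n-1)`. -/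
noncomputable def poch (x : ℝ) (n : ℕ) : ℝ := ∏ i ∈ Finset.range n, (x + i)

/-- The harmonic numbers of order 2, `H_n^{(2)} = ∑_{j=1}^n 1/j²`. -/
noncomputable def H2 (n : ℕ) : ℝ := ∑ j ∈ Finset.range n, 1 / ((j : ℝ) + 1) ^ 2

/-- The Dirichlet beta value `β(4) = ∑_{k≥0} (-1)^k/(1+2k)⁴`. -/
noncomputable def beta4 : ℝ := ∑' k : ℕ, (-1) ^ k / (1 + 2 * (k : ℝ)) ^ 4

/-- The Catalan constant `G = ∑_{k≥0} (-1)^k/(1+2k)²`. -/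
noncomputable def catalanG : ℝ := ∑' k : ℕ, (-1) ^ k / (1 + 2 * (k : ℝ)) ^ 2

theorem poch_zero (x : ℝ) : poch x 0 = 1 := by simp [poch]

theorem poch_succ (x : ℝ) (n : ℕ) : poch x (n + 1) = poch x n * (x + n) := by
  simp [poch, Finset.prod_range_succ]

theorem poch_succ_left (x : ℝ) (n : ℕ) : poch x (n + 1) = x * poch (x + 1) n := by
  simp only [poch, Finset.prod_range_succ', Nat.cast_zero, add_zero, Nat.cast_succ]
  rw [mul_comm]
  congr 1
  exact Finset.prod_congr rfl fun i _ => by ring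

theorem poch_pos {x : ℝ} (hx : 0 < x) (n : ℕ) : 0 < poch x n :=
  Finset.prod_pos fun i _ => by positivity

theorem poch_neg_natCast_eq_zero {n j : ℕ} (h : n < j) : poch (-(n : ℝ)) j = 0 :=
  Finset.prod_eq_zero (Finset.mem_range.mpr h) (by simp)

theorem half_sub_natCast_ne_zero (n j : ℕ) : (1 / 2 - n + j : ℝ) ≠ 0 := by
  intro h
  have h' : (2 * (n : ℤ) : ℝ) = 2 * (j : ℤ) + 1 := by push_cast; linarith
  norm_cast at h'
  omega

theorem poch_half_sub_natCast_ne_zero (n j : ℕ) : poch (1 / 2 - n) j ≠ 0 :=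
  Finset.prod_ne_zero_iff.mpr fun i _ => half_sub_natCast_ne_zero n i

theorem H2_succ (n : ℕ) : H2 (n + 1) = H2 n + 1 / ((n : ℝ) + 1) ^ 2 := by
  simp [H2, Finset.sum_range_succ]

theorem H2_odd_succ (k : ℕ) : H2 (1 + 2 * (k + 1)) =
    H2 (1 + 2 * k) + 1 / (2 * (k : ℝ) + 2) ^ 2 + 1 / (2 * (k : ℝ) + 3) ^ 2 := by
  rw [show 1 + 2 * (k + 1) = (1 + 2 * k) + 1 + 1 by ring, H2_succ, H2_succ]
  push_cast
  ring

/-- The product `(-x)_j (3/2 + x)_j`. -/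
noncomputable def pochPair (x : ℝ) (j : ℕ) : ℝ := poch (-x) j * poch (3 / 2 + x) j

theorem pochPair_succ (x : ℝ) (j : ℕ) :
    pochPair x (j + 1) = pochPair x j * ((j - x) * (j + x + 3 / 2)) := by
  simp only [pochPair, poch_succ]
  ring

theorem pochPair_natCast_eq_zero {k j : ℕ} (h : k < j) : pochPair k j = 0 := by
  simp [pochPair, poch_neg_natCast_eq_zero h]

theorem pochPair_succ_eq (x : ℝ) (j : ℕ) : pochPair x (j + 1) =
    poch (-x) j * poch (5 / 2 + x) j * ((j - x) * (x + 3 / 2)) := by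
  rw [pochPair, poch_succ, poch_succ_left (3 / 2 + x), show 3 / 2 + x + 1 = 5 / 2 + x by ring]
  ring

theorem pochPair_add_one_succ_eq (x : ℝ) (j : ℕ) : pochPair (x + 1) (j + 1) =
    poch (-x) j * poch (5 / 2 + x) j * (-(x + 1) * (x + 5 / 2 + j)) := by
  rw [pochPair, poch_succ (3 / 2 + (x + 1)), poch_succ_left (-(x + 1)),
    show -(x + 1) + 1 = -x by ring, show 3 / 2 + (x + 1) = 5 / 2 + x by ring]
  ring

theorem pochPair_add_one (x : ℝ) (j : ℕ) :
    pochPair (x + 1) j * ((x + 1 - j) * (x + 3 / 2)) =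
      pochPair x j * ((x + 1) * (x + 3 / 2 + j)) := by
  cases j with
  | zero => simp [pochPair, poch_zero]
  | succ j =>
    rw [pochPair_add_one_succ_eq, pochPair_succ_eq]
    push_cast
    ring

/-- The coefficients of the balanced expansion of a very-well-poised factor. -/
noncomputable def saalCoeff (x : ℝ) (j : ℕ) : ℝ := pochPair x j * (poch (1 / 2) j / poch 1 j)

theorem saalCoeff_zero (x : ℝ) : saalCoeff x 0 = 1 := by simp [saalCoeff, pochPair, poch_zero]

theorem saalCoeff_natCast_eq_zero {k j : ℕ} (h : k < j) : saalCoeff k j = 0 := by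
  simp [saalCoeff, pochPair_natCast_eq_zero h]

theorem saalCoeff_succ (x : ℝ) (j : ℕ) : saalCoeff x (j + 1) * (j + 1) =
    saalCoeff x j * ((j - x) * (j + x + 3 / 2) * (1 / 2 + j)) := by
  have := poch_pos one_pos j
  simp only [saalCoeff, pochPair_succ, poch_succ]
  field_simp
  ring

theorem saalCoeff_recurrence (x : ℝ) (j : ℕ) :
    (x + 3 / 2) ^ 2 * saalCoeff (x + 1) j - (x + 1) ^ 2 * saalCoeff x j =
      (j + 1 / 2) ^ 2 * (saalCoeff (x + 1) j - saalCoeff x j) -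
        (saalCoeff (x + 1) (j + 1) - saalCoeff x (j + 1)) := by
  have hj : (j + 1 : ℝ) ≠ 0 := by positivity
  apply mul_right_cancel₀ hj
  have h₁ := saalCoeff_succ (x + 1) j
  have h₂ := saalCoeff_succ x j
  suffices h : ((x + 3 / 2) ^ 2 * saalCoeff (x + 1) j - (x + 1) ^ 2 * saalCoeff x j) * (j + 1) =
      (j + 1 / 2) ^ 2 * (saalCoeff (x + 1) j - saalCoeff x j) * (j + 1) -
        (saalCoeff (x + 1) j * ((j - (x + 1)) * (j + (x + 1) + 3 / 2) * (1 / 2 + j)) -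
          saalCoeff x j * ((j - x) * (j + x + 3 / 2) * (1 / 2 + j))) by
    linear_combination h + h₁ - h₂
  cases j with
  | zero => simp only [saalCoeff_zero, Nat.cast_zero]; ring
  | succ j =>
    simp only [saalCoeff, pochPair_add_one_succ_eq, pochPair_succ_eq x]
    push_cast
    ring

theorem sum_saalCoeff_recurrence (B : ℕ → ℝ) (x : ℝ) (N : ℕ) :
    (x + 3 / 2) ^ 2 * ∑ j ∈ Finset.range N, saalCoeff (x + 1) j * B j -
        (x + 1) ^ 2 * ∑ j ∈ Finset.range N, saalCoeff x j * B j =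
      ∑ j ∈ Finset.range N, (saalCoeff (x + 1) (j + 1) - saalCoeff x (j + 1)) *
          ((j + 3 / 2) ^ 2 * B (j + 1) - B j) -
        (N + 1 / 2) ^ 2 * (saalCoeff (x + 1) N - saalCoeff x N) * B N := by
  induction N with
  | zero => simp [saalCoeff_zero]
  | succ N ih =>
    simp only [Finset.sum_range_succ]
    push_cast
    linear_combination ih + B N * saalCoeff_recurrence x N

theorem natCast_sum_saalCoeff_recurrence (B : ℕ → ℝ) {k N : ℕ} (h : k + 1 < N) :
    ((k : ℝ) + 3 / 2) ^ 2 * ∑ j ∈ Finset.range N, saalCoeff (k + 1 : ℕ) j * B j -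
        ((k : ℝ) + 1) ^ 2 * ∑ j ∈ Finset.range N, saalCoeff k j * B j =
      ∑ j ∈ Finset.range N, (saalCoeff (k + 1 : ℕ) (j + 1) - saalCoeff k (j + 1)) *
          ((j + 3 / 2) ^ 2 * B (j + 1) - B j) := by
  have h₁ := sum_saalCoeff_recurrence B k N
  rw [← Nat.cast_succ, saalCoeff_natCast_eq_zero h,
    saalCoeff_natCast_eq_zero (Nat.lt_of_succ_lt h)] at h₁
  push_cast at h₁ ⊢
  linear_combination h₁

theorem poch_three_half_sq_succ_inv (j : ℕ) :
    ((j : ℝ) + 3 / 2) ^ 2 * (1 / poch (3 / 2) (j + 1) ^ 2) = 1 / poch (3 / 2) j ^ 2 := by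
  have := poch_pos (show (0 : ℝ) < 3 / 2 by norm_num) j
  have : (3 / 2 + j : ℝ) ≠ 0 := by positivity
  rw [poch_succ, add_comm (j : ℝ)]
  field_simp

/-- Pfaff–Saalschütz summation of the squared quotient `((1)_k / (3/2)_k)²`. -/
theorem sum_saalCoeff_eq {k N : ℕ} (h : k < N) :
    ∑ j ∈ Finset.range N, saalCoeff k j * (1 / poch (3 / 2) j ^ 2) =
      poch 1 k ^ 2 / poch (3 / 2) k ^ 2 := by
  induction k with
  | zero =>
    rw [Finset.sum_eq_single_of_mem 0 (Finset.mem_range.mpr h) fun j _ hj => by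
      rw [saalCoeff_natCast_eq_zero (Nat.pos_of_ne_zero hj), zero_mul]]
    simp [saalCoeff_zero, poch_zero]
  | succ k ih =>
    have hr := natCast_sum_saalCoeff_recurrence (fun j => 1 / poch (3 / 2) j ^ 2) h
    rw [ih (Nat.lt_of_succ_lt h)] at hr
    simp only [poch_three_half_sq_succ_inv, sub_self, mul_zero, Finset.sum_const_zero] at hr
    have h₀ : ((k : ℝ) + 3 / 2) ^ 2 ≠ 0 := by positivity
    apply mul_left_cancel₀ h₀
    rw [sub_eq_zero.mp hr, poch_succ 1]
    linear_combination -(poch 1 k * (1 + k)) ^ 2 * poch_three_half_sq_succ_inv k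

/-- The harmonic-number companion of `sum_saalCoeff_eq`. -/
theorem sum_saalCoeff_harmonic_eq {k N : ℕ} (h : k < N) :
    ∑ j ∈ Finset.range N,
        saalCoeff k j * (1 / poch (3 / 2) j ^ 2 * (4 * H2 (1 + 2 * j) - H2 j)) =
      poch 1 k ^ 2 / poch (3 / 2) k ^ 2 * (4 * H2 (1 + 2 * k) - 2 * H2 k) := by
  induction k with
  | zero =>
    rw [Finset.sum_eq_single_of_mem 0 (Finset.mem_range.mpr h) fun j _ hj => by
      rw [saalCoeff_natCast_eq_zero (Nat.pos_of_ne_zero hj), zero_mul]]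
    simp [saalCoeff_zero, poch_zero, H2]
  | succ k ih =>
    have hr := natCast_sum_saalCoeff_recurrence
      (fun j => 1 / poch (3 / 2) j ^ 2 * (4 * H2 (1 + 2 * j) - H2 j)) h
    have hB (j : ℕ) : ((j : ℝ) + 3 / 2) ^ 2 *
          (1 / poch (3 / 2) (j + 1) ^ 2 * (4 * H2 (1 + 2 * (j + 1)) - H2 (j + 1))) -
        1 / poch (3 / 2) j ^ 2 * (4 * H2 (1 + 2 * j) - H2 j) = 1 / poch (3 / 2) (j + 1) ^ 2 := by
      rw [← poch_three_half_sq_succ_inv j, H2_odd_succ, H2_succ]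
      field_simp
      ring
    have hs : ∑ j ∈ Finset.range N, (saalCoeff (k + 1 : ℕ) (j + 1) - saalCoeff k (j + 1)) *
        (1 / poch (3 / 2) (j + 1) ^ 2) =
        poch 1 (k + 1) ^ 2 / poch (3 / 2) (k + 1) ^ 2 - poch 1 k ^ 2 / poch (3 / 2) k ^ 2 := by
      rw [← sum_saalCoeff_eq (h.trans (Nat.lt_succ_self N)),
        ← sum_saalCoeff_eq ((Nat.lt_of_succ_lt h).trans (Nat.lt_succ_self N)),
        ← Finset.sum_sub_distrib, Finset.sum_range_succ']
      simp only [saalCoeff_zero, sub_self, add_zero, sub_mul]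
    simp only [hB, hs] at hr
    rw [ih (Nat.lt_of_succ_lt h)] at hr
    have h₀ : ((k : ℝ) + 3 / 2) ^ 2 ≠ 0 := by positivity
    apply mul_left_cancel₀ h₀
    rw [sub_eq_iff_eq_add.mp hr, H2_odd_succ, H2_succ, poch_succ, poch_succ]
    have := poch_pos (show (0 : ℝ) < 3 / 2 by norm_num) k
    have : (3 / 2 + k : ℝ) ≠ 0 := by positivity
    have : (2 * k + 3 : ℝ) ≠ 0 := by positivity
    have : (k + 1 : ℝ) ≠ 0 := by positivity
    rw [show (k : ℝ) + 3 / 2 = (2 * k + 3) / 2 by ring,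
      show (3 / 2 + k : ℝ) = (2 * k + 3) / 2 by ring,
      show (2 * k + 2 : ℝ) = 2 * (k + 1) by ring, show (1 + k : ℝ) = k + 1 by ring]
    field_simp
    ring

/-- The hypergeometric term `(1)_k (-n)_k / ((3/2)_k (5/2 + n)_k)`. -/
noncomputable def wpTerm (n k : ℕ) : ℝ :=
  poch 1 k * poch (-(n : ℝ)) k / (poch (3 / 2) k * poch (5 / 2 + n) k)

theorem wpTerm_succ (n k : ℕ) : wpTerm n (k + 1) * ((k + 3 / 2) * (k + 5 / 2 + n)) =
    wpTerm n k * ((k + 1) * (k - n)) := by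
  have := poch_pos (show (0 : ℝ) < 3 / 2 by norm_num) k
  have := poch_pos (show (0 : ℝ) < 5 / 2 + n by positivity) k
  have h₁ : (3 / 2 + k : ℝ) ≠ 0 := by positivity
  have h₂ : (5 / 2 + n + k : ℝ) ≠ 0 := by positivity
  simp only [wpTerm, poch_succ]
  rw [show (k + 3 / 2 : ℝ) = 3 / 2 + k by ring, show (k + 5 / 2 + n : ℝ) = 5 / 2 + n + k by ring]
  field_simp
  ring

theorem sum_wpTerm (n : ℕ) :
    ∑ k ∈ Finset.range (n + 1), (3 + 4 * (k : ℝ)) * wpTerm n k = (3 + 2 * n) / (1 + 2 * n) := by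
  have h (m : ℕ) : (1 + 2 * n) * ∑ k ∈ Finset.range m, (3 + 4 * (k : ℝ)) * wpTerm n k =
      3 + 2 * n - 4 * (wpTerm n m * ((m + 1 / 2) * (m + 3 / 2 + n))) := by
    induction m with
    | zero => simp [wpTerm, poch_zero]; ring
    | succ m ih =>
      rw [Finset.sum_range_succ]
      push_cast
      linear_combination ih + 4 * wpTerm_succ n m
  rw [eq_div_iff (by positivity), mul_comm, h]
  simp [wpTerm, poch_neg_natCast_eq_zero (Nat.lt_succ_self n)]

theorem sum_wpTerm_mul_pochPair_succ (n j : ℕ) :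
    (1 / 2 - n + j) *
        ∑ k ∈ Finset.range (n + 1), (3 + 4 * (k : ℝ)) * wpTerm n k * pochPair k (j + 1) =
      (j + 1) ^ 2 * (j - n) *
        ∑ k ∈ Finset.range (n + 1), (3 + 4 * (k : ℝ)) * wpTerm n k * pochPair k j := by
  have h (m : ℕ) : (1 / 2 - n + j) *
        ∑ k ∈ Finset.range m, (3 + 4 * (k : ℝ)) * wpTerm n k * pochPair k (j + 1) -
      (j + 1) ^ 2 * (j - n) *
        ∑ k ∈ Finset.range m, (3 + 4 * (k : ℝ)) * wpTerm n k * pochPair k j =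
      -2 * (wpTerm n m * pochPair m j * ((m + 1 / 2) ^ 2 * (m + 3 / 2 + n) * (m - j))) := by
    induction m with
    | zero =>
      cases j with
      | zero => simp
      | succ j => rw [pochPair_natCast_eq_zero (Nat.succ_pos j)]; simp
    | succ m ih =>
      simp only [Finset.sum_range_succ, pochPair_succ] at ih ⊢
      push_cast
      have h₁ := wpTerm_succ n m
      have h₂ := pochPair_add_one m j
      linear_combination ih
        + 2 * (pochPair (m + 1) j * ((m + 1 - j) * (m + 3 / 2))) * h₁
        + 2 * (wpTerm n m * ((m + 1) * (m - n))) * h₂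
  rw [← sub_eq_zero, h]
  simp [wpTerm, poch_neg_natCast_eq_zero (Nat.lt_succ_self n)]

theorem sum_wpTerm_mul_pochPair (n j : ℕ) :
    ∑ k ∈ Finset.range (n + 1), (3 + 4 * (k : ℝ)) * wpTerm n k * pochPair k j =
      (3 + 2 * n) / (1 + 2 * n) * (poch 1 j ^ 2 * poch (-(n : ℝ)) j / poch (1 / 2 - n) j) := by
  induction j with
  | zero => simp [pochPair, poch_zero, sum_wpTerm]
  | succ j ih =>
    have h₁ := half_sub_natCast_ne_zero n j
    have h₂ := poch_half_sub_natCast_ne_zero n j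
    apply mul_left_cancel₀ h₁
    rw [sum_wpTerm_mul_pochPair_succ, ih]
    simp only [poch_succ]
    generalize poch (1 / 2 - (n : ℝ)) j = p at h₂ ⊢
    generalize (1 / 2 - n + j : ℝ) = c at h₁ ⊢
    field_simp
    ring

theorem sum_wpTerm_mul_saalCoeff (n j : ℕ) :
    ∑ k ∈ Finset.range (n + 1), (3 + 4 * (k : ℝ)) * wpTerm n k * saalCoeff k j =
      (3 + 2 * n) / (1 + 2 * n) *
        (poch (1 / 2) j * poch 1 j * poch (-(n : ℝ)) j / poch (1 / 2 - n) j) := by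
  have := (poch_pos one_pos j).ne'
  simp only [saalCoeff, ← mul_assoc, ← Finset.sum_mul, sum_wpTerm_mul_pochPair]
  field_simp

theorem stmt11 (n : ℕ) :
    (∑ k ∈ Finset.range (n + 1), (3 + 4 * (k : ℝ)) *
        (poch 1 k ^ 3 * poch (-(n : ℝ)) k / (poch (3/2) k ^ 3 * poch (5/2 + n) k)) *
        (4 * H2 (1 + 2 * k) - 2 * H2 k)) =
      (3 + 2 * (n : ℝ)) / (1 + 2 * (n : ℝ)) *
        ∑ k ∈ Finset.range (n + 1),
          poch (1/2) k * poch 1 k * poch (-(n : ℝ)) k /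
            (poch (3/2) k ^ 2 * poch (1/2 - n) k) *
          (4 * H2 (1 + 2 * k) - H2 k) := by
  calc _ = ∑ k ∈ Finset.range (n + 1), ∑ j ∈ Finset.range (n + 1),
        (3 + 4 * (k : ℝ)) * wpTerm n k * saalCoeff k j *
          (1 / poch (3 / 2) j ^ 2 * (4 * H2 (1 + 2 * j) - H2 j)) := by
        refine Finset.sum_congr rfl fun k hk => ?_
        simp only [mul_assoc _ (saalCoeff _ _), ← Finset.mul_sum]
        rw [sum_saalCoeff_harmonic_eq (Finset.mem_range.mp hk), wpTerm]
        field_simp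
    _ = _ := by
        rw [Finset.sum_comm, Finset.mul_sum]
        refine Finset.sum_congr rfl fun j _ => ?_
        rw [← Finset.sum_mul, sum_wpTerm_mul_saalCoeff]
        field_simp
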